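/- arXiv:2412.05001 — 2 statements merged into one kernel-verified Lean document; each statement's English description precedes it below -/
import Mathlib

section
/- Let α : [0,∞) → ℝ be continuous with compact support, let 0 ≤ t₁ ≤ t₂, and set w = u_{t₁} □ u_{t₂}. Then ∫_{dom(w)} α(|∇w(x)|) dx = κ_n (α(t₁) + (2ⁿ − 1) α(t₂)). -/
open MeasureTheory Filter Topology

noncomputable section

abbrev En (n : ℕ) : Type := EuclideanSpace ℝ (Fin n)

/-- The effective domain of an extended-real-valued function. -/
def domFn {n : ℕ} (u : En n → EReal) : Set (En n) := {x | u x ≠ ⊤}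

/-- Infimal convolution. -/
def infConv {n : ℕ} (u v : En n → EReal) : En n → EReal :=
  fun x => ⨅ y : En n, u y + v (x - y)

/-- The (a.e. defined) gradient of an extended-real-valued function, via its real part. -/
def gradFn {n : ℕ} (u : En n → EReal) (x : En n) : En n :=
  gradient (fun y => (u y).toReal) x

/-- The function `u_t`: equal to `t‖x‖` on the unit ball, `∞` outside. -/
def ut {n : ℕ} (t : ℝ) : En n → EReal :=
  fun x => if ‖x‖ ≤ 1 then ((t * ‖x‖ : ℝ) : EReal) else ⊤

/-- The radial profile of `u_{t₁} □ u_{t₂}`. -/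
def infConvProfile (t₁ t₂ r : ℝ) : ℝ := t₁ * min r 1 + t₂ * max (r - 1) 0

lemma infConv_ut_of_norm_le {n : ℕ} {t₁ t₂ : ℝ} (ht₁ : 0 ≤ t₁) (ht : t₁ ≤ t₂) {x : En n}
    (hx : ‖x‖ ≤ 2) :
    infConv (ut t₁) (ut t₂) x = ((infConvProfile t₁ t₂ ‖x‖ : ℝ) : EReal) := by
  apply le_antisymm
  · rcases le_or_gt ‖x‖ 1 with h | h
    · refine (iInf_le _ x).trans (le_of_eq ?_)
      simp [ut, h, infConvProfile]
    · refine (iInf_le _ (‖x‖⁻¹ • x)).trans (le_of_eq ?_)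
      have hpos : 0 < ‖x‖ := by linarith
      have h₁ : ‖‖x‖⁻¹ • x‖ = 1 := by
        rw [norm_smul, norm_inv, norm_norm, inv_mul_cancel₀ hpos.ne']
      have h₂ : ‖x - ‖x‖⁻¹ • x‖ = ‖x‖ - 1 := by
        have : x - ‖x‖⁻¹ • x = (1 - ‖x‖⁻¹) • x := by rw [sub_smul, one_smul]
        rw [this, norm_smul, Real.norm_of_nonneg (sub_nonneg.2 (inv_le_one_of_one_le₀ h.le)),
          sub_mul, one_mul, inv_mul_cancel₀ hpos.ne']
      rw [ut, ut, h₁, h₂, if_pos le_rfl, if_pos (by linarith), ← EReal.coe_add, infConvProfile,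
        min_eq_right h.le, max_eq_left (by linarith)]
  · refine le_iInf fun y => ?_
    unfold ut
    split_ifs with hy hxy
    · rw [← EReal.coe_add, EReal.coe_le_coe_iff, infConvProfile]
      have htri : ‖x‖ ≤ ‖y‖ + ‖x - y‖ := by
        simpa using norm_add_le y (x - y)
      rcases le_or_gt ‖x‖ 1 with h | h
      · rw [min_eq_left h, max_eq_right (by linarith)]
        nlinarith [mul_le_mul_of_nonneg_left htri ht₁,
          mul_le_mul_of_nonneg_right ht (norm_nonneg (x - y))]
      · rw [min_eq_right h.le, max_eq_left (by linarith)]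
        nlinarith [mul_le_mul_of_nonneg_left htri (ht₁.trans ht),
          mul_nonneg (sub_nonneg.2 ht) (sub_nonneg.2 hy)]
    all_goals simp [-EReal.coe_mul]

lemma infConv_ut_of_two_lt_norm {n : ℕ} (t₁ t₂ : ℝ) {x : En n} (hx : 2 < ‖x‖) :
    infConv (ut t₁) (ut t₂) x = ⊤ := by
  refine iInf_eq_top.2 fun y => ?_
  have htri : ‖x‖ ≤ ‖y‖ + ‖x - y‖ := by
    simpa using norm_add_le y (x - y)
  unfold ut
  split_ifs with hy hxy
  · linarith
  all_goals simp [-EReal.coe_mul]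

lemma domFn_infConv_ut {n : ℕ} {t₁ t₂ : ℝ} (ht₁ : 0 ≤ t₁) (ht : t₁ ≤ t₂) :
    domFn (infConv (ut t₁) (ut t₂)) = Metric.closedBall (0 : En n) 2 := by
  ext x
  rw [mem_closedBall_zero_iff, domFn, Set.mem_ofPred_eq]
  rcases le_or_gt ‖x‖ 2 with h | h
  · simp [infConv_ut_of_norm_le ht₁ ht h, h]
  · simp [infConv_ut_of_two_lt_norm t₁ t₂ h, h]

lemma norm_gradient_eq_of_eventuallyEq_affine_norm {E : Type*} [NormedAddCommGroup E]
    [InnerProductSpace ℝ E] [CompleteSpace E] {f : E → ℝ} {c d : ℝ} (hc : 0 ≤ c) {x : E}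
    (hx : x ≠ 0) (hf : f =ᶠ[𝓝 x] fun y => c * ‖y‖ + d) : ‖gradient f x‖ = c := by
  have : Nontrivial E := ⟨x, 0, hx⟩
  have hd : DifferentiableAt ℝ (fun y : E => ‖y‖) x := differentiableAt_id.norm ℝ hx
  rw [gradient, LinearIsometryEquiv.norm_map, hf.fderiv_eq, fderiv_add_const,
    fderiv_const_mul hd, norm_smul, norm_fderiv_norm hd, mul_one, Real.norm_of_nonneg hc]

lemma norm_gradFn_infConv_ut_of_norm_lt_one {n : ℕ} {t₁ t₂ : ℝ} (ht₁ : 0 ≤ t₁) (ht : t₁ ≤ t₂)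
    {x : En n} (hx : x ≠ 0) (h : ‖x‖ < 1) : ‖gradFn (infConv (ut t₁) (ut t₂)) x‖ = t₁ := by
  refine norm_gradient_eq_of_eventuallyEq_affine_norm (d := 0) ht₁ hx ?_
  filter_upwards [continuous_norm.continuousAt.eventually_lt_const h] with y hy
  rw [infConv_ut_of_norm_le ht₁ ht (by linarith), EReal.toReal_coe, infConvProfile,
    min_eq_left hy.le, max_eq_right (by linarith), mul_zero]

lemma norm_gradFn_infConv_ut_of_one_lt_norm {n : ℕ} {t₁ t₂ : ℝ} (ht₁ : 0 ≤ t₁) (ht : t₁ ≤ t₂)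
    {x : En n} (h : 1 < ‖x‖) (h' : ‖x‖ < 2) :
    ‖gradFn (infConv (ut t₁) (ut t₂)) x‖ = t₂ := by
  refine norm_gradient_eq_of_eventuallyEq_affine_norm (d := t₁ - t₂) (ht₁.trans ht)
    (norm_pos_iff.1 (by linarith)) ?_
  filter_upwards [continuous_norm.continuousAt.eventually_const_lt h,
    continuous_norm.continuousAt.eventually_lt_const h'] with y hy hy'
  rw [infConv_ut_of_norm_le ht₁ ht hy'.le, EReal.toReal_coe, infConvProfile,
    min_eq_right hy.le, max_eq_left (by linarith)]
  ring

/-- The value of the `n`-th functional intrinsic volume with density `α`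
on the infimal convolution `u_{t₁} □ u_{t₂}`. Here `κ_n` is the volume of the
Euclidean unit ball in `ℝⁿ`. -/
theorem stmt2 (n : ℕ) (hn : 1 ≤ n) (α : ℝ → ℝ)
    (hcont : ContinuousOn α (Set.Ici 0))
    (hsupp : ∃ T : ℝ, ∀ t : ℝ, T ≤ t → α t = 0)
    (t₁ t₂ : ℝ) (ht₁ : 0 ≤ t₁) (ht : t₁ ≤ t₂) :
    ∫ x in interior (domFn (infConv (ut t₁) (ut t₂ : En n → EReal))),
        α ‖gradFn (infConv (ut t₁) (ut t₂)) x‖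
      = (volume (Metric.closedBall (0 : En n) 1)).toReal *
          (α t₁ + ((2 : ℝ) ^ n - 1) * α t₂) := by
  have : Nonempty (Fin n) := ⟨⟨0, hn⟩⟩
  rw [domFn_infConv_ut ht₁ ht, interior_closedBall _ two_ne_zero]
  have hae : ∀ᵐ x : En n, x ∈ Metric.ball (0 : En n) 2 →
      α ‖gradFn (infConv (ut t₁) (ut t₂)) x‖ =
        α t₂ + (Metric.ball (0 : En n) 1).indicator (fun _ => α t₁ - α t₂) x := by
    have h0 : ∀ᵐ x : En n, x ≠ 0 := by
      simp [ae_iff]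
    have h1 : ∀ᵐ x : En n, x ∉ Metric.sphere (0 : En n) 1 :=
      measure_eq_zero_iff_ae_notMem.1 (Measure.addHaar_sphere volume 0 1)
    filter_upwards [h0, h1] with x hx0 hx1 hx2
    rw [mem_sphere_zero_iff_norm] at hx1
    rw [mem_ball_zero_iff] at hx2
    rcases lt_or_gt_of_ne hx1 with h | h
    · rw [norm_gradFn_infConv_ut_of_norm_lt_one ht₁ ht hx0 h,
        Set.indicator_of_mem (mem_ball_zero_iff.2 h)]
      ring
    · rw [norm_gradFn_infConv_ut_of_one_lt_norm ht₁ ht h hx2,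
        Set.indicator_of_notMem (by rw [mem_ball_zero_iff]; exact h.not_gt), add_zero]
  have hint (c : ℝ) : Integrable (fun _ : En n => c)
      (volume.restrict (Metric.ball (0 : En n) 2)) :=
    integrableOn_const measure_ball_lt_top.ne
  rw [setIntegral_congr_ae measurableSet_ball hae,
    integral_add (hint _) ((hint _).indicator measurableSet_ball),
    setIntegral_const, setIntegral_indicator measurableSet_ball, setIntegral_const,
    Set.inter_eq_right.2 (Metric.ball_subset_ball one_le_two), measureReal_def, measureReal_def,
    Measure.addHaar_ball _ _ zero_le_two, Measure.addHaar_closedBall _ _ zero_le_one,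
    finrank_euclideanSpace_fin, ENNReal.toReal_mul, ENNReal.toReal_ofReal (by positivity)]
  simp only [one_pow, ENNReal.ofReal_one, one_mul, smul_eq_mul]
  ring
end
end

section
/- For all u₁, u₂ ∈ Conv_0(ℝⁿ) and λ₁, λ₂ ≥ 0, the function (λ₁ ⊡ u₁) □ (λ₂ ⊡ u₂) belongs to Conv_0(ℝⁿ) and K^{(λ₁ ⊡ u₁) □ (λ₂ ⊡ u₂)} = λ₁ K^{u₁} + λ₂ K^{u₂}, where the right-hand side is the Minkowski sum of the dilates λᵢ K^{uᵢ} = {λᵢ ξ : ξ ∈ K^{uᵢ}}. -/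
open MeasureTheory Filter Topology Pointwise
open scoped Classical

noncomputable section

/-- The epigraph of an extended-real-valued function, as a subset of `ℝⁿ × ℝ`. -/
def epiSet {n : ℕ} (u : En n → EReal) : Set (En n × ℝ) :=
  {p | u p.1 ≤ (p.2 : EReal)}

/-- Convexity of an extended-real-valued function via its epigraph. -/
def IsConvexFn {n : ℕ} (u : En n → EReal) : Prop := Convex ℝ (epiSet u)

/-- Super-coercivity: `u(x)/‖x‖ → ∞` as `‖x‖ → ∞`. -/
def SuperCoercive {n : ℕ} (u : En n → EReal) : Prop :=
  ∀ c : ℝ, ∃ R : ℝ, ∀ x : En n, R ≤ ‖x‖ → ((c * ‖x‖ : ℝ) : EReal) ≤ u x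

/-- The class `Conv_sc(ℝⁿ)` of proper, l.s.c., super-coercive convex functions
with values in `(-∞,∞]`. -/
def ConvSc {n : ℕ} (u : En n → EReal) : Prop :=
  IsConvexFn u ∧ LowerSemicontinuous u ∧ (∀ x, u x ≠ ⊥) ∧ (∃ x, u x ≠ ⊤) ∧ SuperCoercive u

/-- The class `Conv_cd(ℝⁿ)`: members of `Conv_sc(ℝⁿ)` with compact domain. -/
def ConvCd {n : ℕ} (u : En n → EReal) : Prop :=
  ConvSc u ∧ IsCompact (domFn u)

/-- The class `Conv_0(ℝⁿ)`: members of `Conv_cd(ℝⁿ)` that are non-positive on their domain. -/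
def Conv0 {n : ℕ} (u : En n → EReal) : Prop :=
  ConvCd u ∧ ∀ x ∈ domFn u, u x ≤ 0

/-- Reflection at the hyperplane `H = e_{n+1}^⊥`, identified with `ℝⁿ × ℝ ∋ (x,t) ↦ (x,-t)`. -/
def reflH {n : ℕ} (p : En n × ℝ) : En n × ℝ := (p.1, -p.2)

/-- The convex body `K^u = epi(u) ∩ refl_H(epi(u))` associated with `u ∈ Conv_0(ℝⁿ)`. -/
def Ku {n : ℕ} (u : En n → EReal) : Set (En n × ℝ) :=
  epiSet u ∩ reflH '' epiSet u

/-- Epi-multiplication `λ ⊡ u`, with `0 ⊡ u = I_{{0}}`. -/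
def epiMul {n : ℕ} (l : ℝ) (u : En n → EReal) : En n → EReal :=
  fun x => if l = 0 then (if x = 0 then (0 : EReal) else ⊤) else (l : EReal) * u (l⁻¹ • x)

theorem mem_Ku {n : ℕ} {u : En n → EReal} {p : En n × ℝ} :
    p ∈ Ku u ↔ u p.1 ≤ (p.2 : EReal) ∧ u p.1 ≤ ((-p.2 : ℝ) : EReal) := by
  obtain ⟨x, t⟩ := p
  constructor
  · rintro ⟨h, ⟨⟨y, s⟩, hs, he⟩⟩
    simp only [reflH, Prod.mk.injEq] at he
    obtain ⟨rfl, rfl⟩ := he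
    exact ⟨h, by simpa [epiSet] using hs⟩
  · rintro ⟨h, h'⟩
    exact ⟨h, (x, -t), h', by simp [reflH]⟩

theorem lowerSemicontinuous_of_isClosed_real_sublevel {X : Type*} [TopologicalSpace X]
    {f : X → EReal} (h : ∀ t : ℝ, IsClosed {x | f x ≤ (t : EReal)}) : LowerSemicontinuous f := by
  rw [lowerSemicontinuous_iff_isClosed_preimage]
  intro a
  induction a with
  | bot =>
    have : f ⁻¹' Set.Iic ⊥ = ⋂ t : ℝ, {x | f x ≤ (t : EReal)} := by
      ext x
      simp only [Set.mem_preimage, Set.mem_Iic, le_bot_iff, Set.mem_iInter, Set.mem_ofPred_eq]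
      refine ⟨fun hx t => hx ▸ bot_le, fun hx => ?_⟩
      rw [EReal.eq_bot_iff_forall_lt]
      intro y
      refine (hx (y - 1)).trans_lt ?_
      exact_mod_cast sub_one_lt y
    rw [this]
    exact isClosed_iInter h
  | coe t => exact h t
  | top => simp

theorem coe_mul_le_coe_iff {l : ℝ} (hl : 0 < l) (a : EReal) (t : ℝ) :
    (l : EReal) * a ≤ (t : EReal) ↔ a ≤ ((l⁻¹ * t : ℝ) : EReal) := by
  induction a with
  | bot => simp [EReal.coe_mul_bot_of_pos hl]
  | coe a =>
    rw [← EReal.coe_mul, EReal.coe_le_coe_iff, EReal.coe_le_coe_iff, le_inv_mul_iff₀ hl]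
  | top =>
    rw [EReal.coe_mul_top_of_pos hl]
    exact iff_of_false (EReal.coe_lt_top t).not_ge (EReal.coe_lt_top _).not_ge

theorem superCoercive_of_isCompact_domFn {n : ℕ} {u : En n → EReal}
    (h : IsCompact (domFn u)) : SuperCoercive u := by
  intro c
  obtain ⟨R, hR⟩ := h.isBounded.exists_norm_le
  refine ⟨R + 1, fun x hx => ?_⟩
  have : u x = ⊤ := by
    by_contra hne
    linarith [hR x hne]
  simp [this]

theorem Ku_nonempty {n : ℕ} {u : En n → EReal} (hu : Conv0 u) : (Ku u).Nonempty := by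
  obtain ⟨⟨⟨-, -, -, ⟨x, hx⟩, -⟩, -⟩, h0⟩ := hu
  exact ⟨(x, 0), mem_Ku.2 (by simpa using h0 x hx)⟩

section EpiMul

variable {n : ℕ} {u : En n → EReal}

theorem epiMul_zero_le_coe_iff (x : En n) (t : ℝ) :
    epiMul 0 u x ≤ (t : EReal) ↔ x = 0 ∧ 0 ≤ t := by
  by_cases hx : x = 0 <;> simp [epiMul, hx]

theorem epiMul_le_coe_iff {l : ℝ} (hl : 0 < l) (x : En n) (t : ℝ) :
    epiMul l u x ≤ (t : EReal) ↔ u (l⁻¹ • x) ≤ ((l⁻¹ * t : ℝ) : EReal) := by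
  simp [epiMul, hl.ne', coe_mul_le_coe_iff hl]

theorem domFn_epiMul_zero : domFn (epiMul 0 u) = {0} := by
  ext x
  by_cases hx : x = 0 <;> simp [domFn, epiMul, hx]

theorem domFn_epiMul {l : ℝ} (hl : 0 < l) : domFn (epiMul l u) = l • domFn u := by
  ext x
  rw [Set.mem_smul_set_iff_inv_smul_mem₀ hl.ne']
  simp only [domFn, epiMul, hl.ne', if_false, Set.mem_ofPred_eq, ne_eq]
  induction u (l⁻¹ • x) with
  | bot => simp [EReal.coe_mul_bot_of_pos hl]
  | coe a => simp [← EReal.coe_mul]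
  | top => simp [EReal.coe_mul_top_of_pos hl]

theorem conv0_epiMul_zero : Conv0 (epiMul 0 u) := by
  have hc : IsCompact (domFn (epiMul 0 u)) := by
    rw [domFn_epiMul_zero]; exact isCompact_singleton
  refine ⟨⟨⟨?_, ?_, ?_, ⟨0, by simp [epiMul]⟩, superCoercive_of_isCompact_domFn hc⟩, hc⟩, ?_⟩
  · have : epiSet (epiMul 0 u) = ({0} : Set (En n)) ×ˢ Set.Ici (0 : ℝ) := by
      ext p; simp [epiSet, epiMul_zero_le_coe_iff]
    rw [IsConvexFn, this]
    exact (convex_singleton _).prod (convex_Ici _)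
  · refine lowerSemicontinuous_of_isClosed_real_sublevel fun t => ?_
    simp only [epiMul_zero_le_coe_iff]
    exact isClosed_singleton.inter isClosed_const
  · intro x
    by_cases hx : x = 0 <;> simp [epiMul, hx]
  · rw [domFn_epiMul_zero]
    rintro x rfl
    simp [epiMul]

theorem conv0_epiMul (hu : Conv0 u) {l : ℝ} (hl : 0 ≤ l) : Conv0 (epiMul l u) := by
  rcases hl.eq_or_lt with rfl | hl
  · exact conv0_epiMul_zero
  obtain ⟨⟨⟨hconv, hlsc, hbot, ⟨x₀, hx₀⟩, -⟩, hcomp⟩, h0⟩ := hu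
  have hc : IsCompact (domFn (epiMul l u)) := by
    rw [domFn_epiMul hl]; exact hcomp.smul l
  refine ⟨⟨⟨?_, ?_, ?_, ⟨l • x₀, ?_⟩, superCoercive_of_isCompact_domFn hc⟩, hc⟩, ?_⟩
  · have : epiSet (epiMul l u) = l • epiSet u := by
      ext p
      rw [Set.mem_smul_set_iff_inv_smul_mem₀ hl.ne']
      exact epiMul_le_coe_iff hl p.1 p.2
    rw [IsConvexFn, this]
    exact hconv.smul l
  · refine lowerSemicontinuous_of_isClosed_real_sublevel fun t => ?_
    simp only [epiMul_le_coe_iff hl]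
    exact (hlsc.isClosed_preimage _).preimage (continuous_const_smul l⁻¹)
  · intro x
    simp only [epiMul, hl.ne', if_false]
    have := hbot (l⁻¹ • x)
    induction h : u (l⁻¹ • x) with
    | bot => exact absurd h this
    | coe a => simp [← EReal.coe_mul]
    | top => simp [EReal.coe_mul_top_of_pos hl]
  · change l • x₀ ∈ domFn (epiMul l u)
    rw [domFn_epiMul hl]
    exact Set.smul_mem_smul_set hx₀
  · intro x hx
    rw [domFn_epiMul hl, Set.mem_smul_set_iff_inv_smul_mem₀ hl.ne'] at hx
    have := (epiMul_le_coe_iff hl x 0).2 (by simpa using h0 _ hx)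
    simpa using this

theorem Ku_epiMul (hu : Conv0 u) {l : ℝ} (hl : 0 ≤ l) : Ku (epiMul l u) = l • Ku u := by
  rcases hl.eq_or_lt with rfl | hl
  · rw [Set.zero_smul_set (Ku_nonempty hu)]
    ext p
    rw [mem_Ku, epiMul_zero_le_coe_iff, epiMul_zero_le_coe_iff, Set.mem_zero, Prod.ext_iff]
    constructor
    · rintro ⟨⟨h, h1⟩, -, h2⟩
      exact ⟨h, by simp only [Prod.snd_zero]; linarith⟩
    · rintro ⟨h1, h2⟩
      simp_all
  · ext p
    rw [Set.mem_smul_set_iff_inv_smul_mem₀ hl.ne', mem_Ku, mem_Ku, epiMul_le_coe_iff hl,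
      epiMul_le_coe_iff hl]
    simp

end EpiMul

section InfConv

variable {n : ℕ} {u v : En n → EReal}

theorem lowerSemicontinuous_add_prod (hu : LowerSemicontinuous u) (hv : LowerSemicontinuous v)
    (hub : ∀ x, u x ≠ ⊥) (hvb : ∀ x, v x ≠ ⊥) :
    LowerSemicontinuous fun p : En n × En n => u p.1 + v p.2 :=
  (hu.comp continuous_fst).add' (hv.comp continuous_snd)
    fun p => EReal.continuousAt_add (Or.inr (hvb p.2)) (Or.inl (hub p.1))

theorem exists_infConv_eq (hu : ConvCd u) (hv : ConvCd v) (x : En n) :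
    ∃ y, infConv u v x = u y + v (x - y) := by
  obtain ⟨⟨-, hul, hub, hne, -⟩, hc⟩ := hu
  obtain ⟨⟨-, hvl, hvb, -, -⟩, -⟩ := hv
  have hl : LowerSemicontinuous fun y => u y + v (x - y) :=
    (lowerSemicontinuous_add_prod hul hvl hub hvb).comp
      (g := fun y => (y, x - y)) (by fun_prop)
  obtain ⟨y, -, hmin⟩ := (hl.lowerSemicontinuousOn (domFn u)).exists_isMinOn hne hc
  refine ⟨y, le_antisymm (iInf_le _ y) (le_iInf fun z => ?_)⟩
  by_cases hz : z ∈ domFn u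
  · exact hmin hz
  · have : u z = ⊤ := by simpa [domFn] using hz
    rw [this, EReal.top_add_of_ne_bot (hvb _)]
    exact le_top

theorem infConv_add_le (x y : En n) : infConv u v (x + y) ≤ u x + v y := by
  have := iInf_le (fun z => u z + v (x + y - z)) x
  rwa [add_sub_cancel_left] at this

theorem exists_coe_of_mem_domFn (hu : ConvSc u) {x : En n} (hx : x ∈ domFn u) :
    ∃ a : ℝ, u x = a :=
  ⟨(u x).toReal, (EReal.coe_toReal hx (hu.2.2.1 x)).symm⟩

theorem mem_domFn_of_add_ne_top (hu : ConvSc u) (hv : ConvSc v) {x y : En n}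
    (h : u x + v y ≠ ⊤) : x ∈ domFn u ∧ y ∈ domFn v := by
  refine ⟨fun hx => h ?_, fun hy => h ?_⟩
  · rw [hx, EReal.top_add_of_ne_bot (hv.2.2.1 y)]
  · rw [hy, EReal.add_top_of_ne_bot (hu.2.2.1 x)]

theorem exists_infConv_coe (hu : ConvCd u) (hv : ConvCd v) {x : En n}
    (hx : x ∈ domFn (infConv u v)) :
    ∃ y z : En n, ∃ a b : ℝ, y + z = x ∧ u y = a ∧ v z = b ∧
      infConv u v x = ((a + b : ℝ) : EReal) := by
  obtain ⟨y, hy⟩ := exists_infConv_eq hu hv x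
  obtain ⟨h1, h2⟩ := mem_domFn_of_add_ne_top hu.1 hv.1 (show _ ≠ ⊤ from hy ▸ (show infConv u v x ≠ ⊤ from hx))
  obtain ⟨a, ha⟩ := exists_coe_of_mem_domFn hu.1 h1
  obtain ⟨b, hb⟩ := exists_coe_of_mem_domFn hv.1 h2
  exact ⟨y, x - y, a, b, by abel, ha, hb, by rw [hy, ha, hb, EReal.coe_add]⟩

theorem mem_domFn_of_le_coe {x : En n} {t : ℝ} (h : u x ≤ (t : EReal)) : x ∈ domFn u :=
  (h.trans_lt (EReal.coe_lt_top t)).ne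

theorem domFn_infConv (hu : ConvCd u) (hv : ConvCd v) :
    domFn (infConv u v) = domFn u + domFn v := by
  ext x
  constructor
  · intro hx
    obtain ⟨y, z, a, b, rfl, ha, hb, -⟩ := exists_infConv_coe hu hv hx
    exact Set.add_mem_add (mem_domFn_of_le_coe ha.le) (mem_domFn_of_le_coe hb.le)
  · rintro ⟨y, hy, z, hz, rfl⟩
    exact ((infConv_add_le y z).trans_lt (EReal.add_lt_top hy hz)).ne

theorem epiSet_infConv (hu : ConvCd u) (hv : ConvCd v) :
    epiSet (infConv u v) = epiSet u + epiSet v := by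
  ext ⟨x, t⟩
  constructor
  · intro h
    change infConv u v x ≤ t at h
    obtain ⟨y, z, a, b, rfl, ha, hb, hab⟩ := exists_infConv_coe hu hv (mem_domFn_of_le_coe h)
    rw [hab, EReal.coe_le_coe_iff] at h
    refine ⟨(y, a), ha.le, (z, t - a), ?_, by simp⟩
    change v z ≤ ((t - a : ℝ) : EReal)
    rw [hb, EReal.coe_le_coe_iff]
    linarith
  · rintro ⟨⟨y, s⟩, hy, ⟨z, r⟩, hz, he⟩
    simp only [Prod.mk_add_mk, Prod.mk.injEq] at he
    obtain ⟨rfl, rfl⟩ := he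
    change infConv u v (y + z) ≤ ((s + r : ℝ) : EReal)
    rw [EReal.coe_add]
    exact (infConv_add_le y z).trans (add_le_add hy hz)

theorem conv0_infConv (hu : Conv0 u) (hv : Conv0 v) : Conv0 (infConv u v) := by
  have hc : IsCompact (domFn (infConv u v)) := by
    rw [domFn_infConv hu.1 hv.1]
    exact hu.1.2.add hv.1.2
  refine ⟨⟨⟨?_, ?_, ?_, ?_, superCoercive_of_isCompact_domFn hc⟩, hc⟩, ?_⟩
  · rw [IsConvexFn, epiSet_infConv hu.1 hv.1]
    exact hu.1.1.1.add hv.1.1.1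
  · refine lowerSemicontinuous_of_isClosed_real_sublevel fun t => ?_
    have hS : IsCompact ((domFn u ×ˢ domFn v) ∩ {p : En n × En n | u p.1 + v p.2 ≤ (t : EReal)}) :=
      (hu.1.2.prod hv.1.2).inter_right
        ((lowerSemicontinuous_add_prod hu.1.1.2.1 hv.1.1.2.1 hu.1.1.2.2.1
          hv.1.1.2.2.1).isClosed_preimage _)
    have : {x | infConv u v x ≤ (t : EReal)} = (fun p : En n × En n => p.1 + p.2) ''
        ((domFn u ×ˢ domFn v) ∩ {p : En n × En n | u p.1 + v p.2 ≤ (t : EReal)}) := by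
      ext x
      constructor
      · intro h
        obtain ⟨y, z, a, b, rfl, ha, hb, hab⟩ :=
          exists_infConv_coe hu.1 hv.1 (mem_domFn_of_le_coe h)
        refine ⟨(y, z), ⟨⟨mem_domFn_of_le_coe ha.le, mem_domFn_of_le_coe hb.le⟩, ?_⟩, rfl⟩
        change u y + v z ≤ t
        rw [ha, hb, ← EReal.coe_add, ← hab]
        exact h
      · rintro ⟨⟨y, z⟩, ⟨-, h⟩, rfl⟩
        exact (infConv_add_le y z).trans h
    rw [this]
    exact (hS.image (by fun_prop)).isClosed
  · intro x hx
    obtain ⟨y, z, a, b, -, -, -, hab⟩ :=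
      exists_infConv_coe hu.1 hv.1 (x := x) (by simp [domFn, hx])
    exact EReal.coe_ne_bot _ (hab ▸ hx)
  · obtain ⟨x, hx⟩ := hu.1.1.2.2.2.1
    obtain ⟨y, hy⟩ := hv.1.1.2.2.2.1
    refine ⟨x + y, ?_⟩
    change x + y ∈ domFn (infConv u v)
    rw [domFn_infConv hu.1 hv.1]
    exact Set.add_mem_add hx hy
  · rw [domFn_infConv hu.1 hv.1]
    rintro _ ⟨y, hy, z, hz, rfl⟩
    exact (infConv_add_le y z).trans (add_nonpos (hu.2 y hy) (hv.2 z hz))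

theorem exists_add_eq_abs_le {a b t : ℝ} (ha : a ≤ 0) (hb : b ≤ 0) (h : a + b ≤ t)
    (h' : a + b ≤ -t) : ∃ s r : ℝ, s + r = t ∧ a ≤ s ∧ a ≤ -s ∧ b ≤ r ∧ b ≤ -r := by
  rcases le_total a t with h1 | h1
  · rcases le_total a (-t) with h2 | h2
    · exact ⟨t, 0, by simp, h1, h2, hb, by simpa using hb⟩
    · exact ⟨-a, t + a, by ring, by linarith, by linarith, by linarith, by linarith⟩
  · exact ⟨a, t - a, by ring, by linarith, by linarith, by linarith, by linarith⟩

theorem Ku_infConv (hu : Conv0 u) (hv : Conv0 v) : Ku (infConv u v) = Ku u + Ku v := by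
  ext ⟨x, t⟩
  constructor
  · intro h
    obtain ⟨h1, h2⟩ := mem_Ku.1 h
    dsimp only at h1 h2
    obtain ⟨y, z, a, b, rfl, ha, hb, hab⟩ :=
      exists_infConv_coe hu.1 hv.1 (mem_domFn_of_le_coe h1)
    rw [hab, EReal.coe_le_coe_iff] at h1 h2
    have ha0 : a ≤ 0 := by
      have := hu.2 y (mem_domFn_of_le_coe ha.le)
      rw [ha] at this
      exact_mod_cast this
    have hb0 : b ≤ 0 := by
      have := hv.2 z (mem_domFn_of_le_coe hb.le)
      rw [hb] at this
      exact_mod_cast this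
    obtain ⟨s, r, rfl, hs, hs', hr, hr'⟩ := exists_add_eq_abs_le ha0 hb0 h1 h2
    refine ⟨(y, s), mem_Ku.2 ?_, (z, r), mem_Ku.2 ?_, rfl⟩
    · dsimp only
      rw [ha, EReal.coe_le_coe_iff, EReal.coe_le_coe_iff]
      exact ⟨hs, hs'⟩
    · dsimp only
      rw [hb, EReal.coe_le_coe_iff, EReal.coe_le_coe_iff]
      exact ⟨hr, hr'⟩
  · rintro ⟨⟨y, s⟩, hy, ⟨z, r⟩, hz, he⟩
    simp only [Prod.mk_add_mk, Prod.mk.injEq] at he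
    obtain ⟨rfl, rfl⟩ := he
    obtain ⟨hy1, hy2⟩ := mem_Ku.1 hy
    obtain ⟨hz1, hz2⟩ := mem_Ku.1 hz
    refine mem_Ku.2 ⟨?_, ?_⟩ <;> dsimp only
    · rw [EReal.coe_add]
      exact (infConv_add_le y z).trans (add_le_add hy1 hz1)
    · rw [neg_add, EReal.coe_add]
      exact (infConv_add_le y z).trans (add_le_add hy2 hz2)

end InfConv

/-- `K^{(λ₁ ⊡ u₁) □ (λ₂ ⊡ u₂)} = λ₁ K^{u₁} + λ₂ K^{u₂}`. -/
theorem stmt9 (n : ℕ) (hn : 1 ≤ n) (u₁ u₂ : En n → EReal) (hu₁ : Conv0 u₁) (hu₂ : Conv0 u₂)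
    (l₁ l₂ : ℝ) (hl₁ : 0 ≤ l₁) (hl₂ : 0 ≤ l₂) :
    Conv0 (infConv (epiMul l₁ u₁) (epiMul l₂ u₂)) ∧
    Ku (infConv (epiMul l₁ u₁) (epiMul l₂ u₂)) = l₁ • Ku u₁ + l₂ • Ku u₂ := by
  have h₁ := conv0_epiMul hu₁ hl₁
  have h₂ := conv0_epiMul hu₂ hl₂
  refine ⟨conv0_infConv h₁ h₂, ?_⟩
  rw [Ku_infConv h₁ h₂, Ku_epiMul hu₁ hl₁, Ku_epiMul hu₂ hl₂]
end
end
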